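/- Let φ be a 3-CNF formula with m ≥ 2 clauses over n ≥ 4 variables, each clause containing exactly three literals on three pairwise distinct variables, and every variable occurring (in some polarity) in at least one clause. If φ has a satisfying truth assignment, then G(φ) admits a strong conflict-free vertex-connection 3-coloring. In fact, given a satisfying assignment, the 3-coloring f with f(a) = f(c_j) = 2 for all j, f(b) = f(c) = 0, f(d) = 1, f(c_j^a) = 0 and f(c_j^b) = 1 for all j, and, for each variable x, f(v_x) = 1 and f(v_x̄) = 0 if x is true, f(v_x) = 0 and f(v_x̄) = 1 if x is false, is a strong conflict-free vertex-connection 3-coloring of G(φ). -/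

import Mathlib

open SimpleGraph

/-- Vertices of the graph `G(φ)`: four special vertices `a, b, c, d`, a literal vertex
`lit x s` for each variable `x` and polarity `s` (`lit x true = v_x`,
`lit x false = v_x̄`), and for each clause `j` the triangle `cl j, cla j, clb j`. -/
inductive GV (n m : ℕ) where
  | a | b | c | d
  | lit : Fin n → Bool → GV n m
  | cl : Fin m → GV n m
  | cla : Fin m → GV n m
  | clb : Fin m → GV n m
deriving DecidableEq

/-- The graph `G(φ)` built from a 3-CNF formula `φ` whose `j`-th clause consists of the
three literals `Cl j 0, Cl j 1, Cl j 2` (a literal being a pair of a variable and a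
polarity). -/
def Gphi {n m : ℕ} (Cl : Fin m → Fin 3 → Fin n × Bool) : SimpleGraph (GV n m) :=
  SimpleGraph.fromRel (fun x y =>
    match x, y with
    | .a, .b => True
    | .a, .c => True
    | .a, .d => True
    | .b, .d => True
    | .c, .d => True
    | .lit x s, .lit x' s' => x = x' ∧ s ≠ s'
    | .a, .lit _ _ => True
    | .cl j, .cla j' => j = j'
    | .cl j, .clb j' => j = j'
    | .cla j, .clb j' => j = j'
    | .cl j, .lit x s => ∃ t, Cl j t = (x, s)
    | .c, .cl _ => True
    | .a, .cla _ => True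
    | .b, .clb _ => True
    | _, _ => False)

/-- `f` is a strong conflict-free vertex-connection coloring of `G`: any two distinct
vertices are joined by a shortest path on which some color occurs exactly once. -/
def IsSCFVC {V α : Type*} [DecidableEq α] (G : SimpleGraph V) (f : V → α) : Prop :=
  ∀ u v : V, u ≠ v → ∃ p : G.Walk u v, p.length = G.dist u v ∧
    ∃ c : α, (p.support.map f).count c = 1

/-- Any pair joined by a conflict-free walk of length at most `3` is fine once `f` is proper. -/
def PairOK {V α : Type*} [DecidableEq α] (G : SimpleGraph V) (f : V → α) (u v : V) : Prop :=
  ∃ p : G.Walk u v, p.length = G.dist u v ∧ ∃ c : α, (p.support.map f).count c = 1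

theorem PairOK.symm {V α : Type*} [DecidableEq α] {G : SimpleGraph V} {f : V → α} {u v : V}
    (h : PairOK G f u v) : PairOK G f v u := by
  obtain ⟨p, hp, c, hc⟩ := h
  refine ⟨p.reverse, by rw [Walk.length_reverse, hp, SimpleGraph.dist_comm], c, ?_⟩
  rw [Walk.support_reverse, List.map_reverse, List.count_reverse, hc]

theorem pairOK_one {V : Type*} {G : SimpleGraph V} {f : V → Fin 3}
    (hf : ∀ x y, G.Adj x y → f x ≠ f y) {u v : V} (h : G.Adj u v) : PairOK G f u v := by
  refine ⟨Walk.cons h Walk.nil, by simp [SimpleGraph.dist_eq_one_iff_adj.2 h], f u, ?_⟩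
  have := hf _ _ h
  simp [this.symm]

/-- A shortest walk of length at most two is conflict-free. -/
theorem pairOK_short {V : Type*} {G : SimpleGraph V} {f : V → Fin 3}
    (hf : ∀ x y, G.Adj x y → f x ≠ f y) {u v : V} (hne : u ≠ v) (p : G.Walk u v)
    (hp : p.length = G.dist u v) (h2 : p.length ≤ 2) : PairOK G f u v := by
  refine ⟨p, hp, ?_⟩
  match p, h2 with
  | .nil, _ => exact absurd rfl hne
  | .cons h .nil, _ =>
    have := hf _ _ h
    exact ⟨f u, by simp [this.symm]⟩
  | .cons (v := w) h (.cons h' .nil), _ =>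
    have h1 := hf _ _ h
    have h2 := hf _ _ h'
    exact ⟨f w, by simp [h1, h2.symm]⟩
  | .cons _ (.cons _ (.cons _ _)), h2 => simp at h2

theorem pairOK_two {V : Type*} {G : SimpleGraph V} {f : V → Fin 3}
    (hf : ∀ x y, G.Adj x y → f x ≠ f y) {u v : V} (w : V) (hne : u ≠ v)
    (h1 : G.Adj u w) (h2 : G.Adj w v) : PairOK G f u v := by
  let q : G.Walk u v := .cons h1 (.cons h2 .nil)
  obtain ⟨p, hp⟩ := q.reachable.exists_walk_length_eq_dist
  exact pairOK_short hf hne p hp (hp.trans_le (SimpleGraph.dist_le q))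

theorem pairOK_three {V : Type*} {G : SimpleGraph V} {f : V → Fin 3}
    (hf : ∀ x y, G.Adj x y → f x ≠ f y) {u v : V} (w z : V) (hne : u ≠ v)
    (h1 : G.Adj u w) (h2 : G.Adj w z) (h3 : G.Adj z v)
    (hc : ∃ c, [f u, f w, f z, f v].count c = 1) : PairOK G f u v := by
  let q : G.Walk u v := .cons h1 (.cons h2 (.cons h3 .nil))
  obtain ⟨p, hp⟩ := q.reachable.exists_walk_length_eq_dist
  by_cases h : p.length ≤ 2
  · exact pairOK_short hf hne p hp h
  · have hq : G.dist u v ≤ 3 := SimpleGraph.dist_le q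
    refine ⟨q, ?_, hc⟩
    change 3 = _
    omega

/-- If the 3-CNF formula `φ` (with `m ≥ 2` clauses over `n ≥ 4` variables, each clause on
three pairwise distinct variables, every variable occurring) is satisfiable, then `G(φ)`
admits a strong conflict-free vertex-connection `3`-coloring; in fact, given a satisfying
assignment `σ`, the coloring `f(a) = f(c_j) = 2`, `f(b) = f(c) = 0`, `f(d) = 1`,
`f(c_j^a) = 0`, `f(c_j^b) = 1`, `f(v_x) = 1` and `f(v_x̄) = 0` when `σ x` is true,
`f(v_x) = 0` and `f(v_x̄) = 1` when `σ x` is false, is such a coloring. -/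
theorem stmt12 {n m : ℕ} (hm : 2 ≤ m) (hn : 4 ≤ n)
    (Cl : Fin m → Fin 3 → Fin n × Bool)
    (hdistinct : ∀ j, ∀ t t' : Fin 3, t ≠ t' → (Cl j t).1 ≠ (Cl j t').1)
    (hoccur : ∀ x : Fin n, ∃ j t, (Cl j t).1 = x)
    (σ : Fin n → Bool) (hσ : ∀ j : Fin m, ∃ t : Fin 3, σ (Cl j t).1 = (Cl j t).2) :
    IsSCFVC (Gphi Cl) (fun w =>
      match w with
      | .a => (2 : Fin 3)
      | .b => 0
      | .c => 0
      | .d => 1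
      | .lit x s => if σ x = s then 1 else 0
      | .cl _ => 2
      | .cla _ => 0
      | .clb _ => 1) ∧
    ∃ f : GV n m → Fin 3, IsSCFVC (Gphi Cl) f := by
  refine (fun h => ⟨h, _, h⟩) ?_
  generalize hfd : (fun w : GV n m => _) = f
  have fa : f .a = 2 := by rw [← hfd]
  have fb : f .b = 0 := by rw [← hfd]
  have fc : f .c = 0 := by rw [← hfd]
  have fd : f .d = 1 := by rw [← hfd]
  have fl : ∀ x s, f (.lit x s) = if σ x = s then 1 else 0 := by intro x s; rw [← hfd]
  have fj : ∀ j, f (.cl j) = 2 := by intro j; rw [← hfd]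
  have fja : ∀ j, f (.cla j) = 0 := by intro j; rw [← hfd]
  have fjb : ∀ j, f (.clb j) = 1 := by intro j; rw [← hfd]
  clear hfd
  have hf : ∀ x y, (Gphi Cl).Adj x y → f x ≠ f y := by
    intro x y h
    rcases x with _ | _ | _ | _ | ⟨x, s⟩ | j | j | j <;>
    rcases y with _ | _ | _ | _ | ⟨y, s'⟩ | k | k | k <;>
    simp [Gphi, SimpleGraph.fromRel_adj] at h <;>
    simp only [fa, fb, fc, fd, fl, fj, fja, fjb] <;>
    first | grind | (have hxy : x = y := by grind
                     subst hxy
                     cases s <;> cases s' <;> cases hs : σ x <;> simp at h ⊢)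
  have eab : (Gphi Cl).Adj .a .b := by simp [Gphi]
  have eac : (Gphi Cl).Adj .a .c := by simp [Gphi]
  have ead : (Gphi Cl).Adj .a .d := by simp [Gphi]
  have ebd : (Gphi Cl).Adj .b .d := by simp [Gphi]
  have ecd : (Gphi Cl).Adj .c .d := by simp [Gphi]
  have eal : ∀ x s, (Gphi Cl).Adj .a (.lit x s) := by simp [Gphi]
  have ej1 : ∀ j, (Gphi Cl).Adj (.cl j) (.cla j) := by simp [Gphi]
  have ej2 : ∀ j, (Gphi Cl).Adj (.cl j) (.clb j) := by simp [Gphi]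
  have ej3 : ∀ j, (Gphi Cl).Adj (.cla j) (.clb j) := by simp [Gphi]
  have ecj : ∀ j, (Gphi Cl).Adj .c (.cl j) := by simp [Gphi]
  have eaj : ∀ j, (Gphi Cl).Adj .a (.cla j) := by simp [Gphi]
  have ebj : ∀ j, (Gphi Cl).Adj .b (.clb j) := by simp [Gphi]
  have ht : ∀ j, ∃ x s, (Gphi Cl).Adj (.cl j) (.lit x s) ∧ f (.lit x s) = 1 := by
    intro j
    obtain ⟨t, h⟩ := hσ j
    refine ⟨(Cl j t).1, (Cl j t).2, ?_, by rw [fl, if_pos h]⟩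
    simp only [Gphi, SimpleGraph.fromRel_adj]
    exact ⟨by simp, Or.inl ⟨t, rfl⟩⟩
  have P1 : ∀ {u v}, (Gphi Cl).Adj u v → PairOK (Gphi Cl) f u v := fun h => pairOK_one hf h
  -- pairs involving `a`
  have Qa : ∀ v, GV.a ≠ v → PairOK (Gphi Cl) f .a v := by
    intro v hv
    rcases v with _ | _ | _ | _ | ⟨y, s'⟩ | k | k | k
    · exact absurd rfl hv
    · exact P1 eab
    · exact P1 eac
    · exact P1 ead
    · exact P1 (eal _ _)
    · exact pairOK_two hf .c hv eac (ecj k)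
    · exact P1 (eaj k)
    · exact pairOK_two hf .b hv eab (ebj k)
  have Qb : ∀ v, GV.b ≠ v → PairOK (Gphi Cl) f .b v := by
    intro v hv
    rcases v with _ | _ | _ | _ | ⟨y, s'⟩ | k | k | k
    · exact (Qa _ hv.symm).symm
    · exact absurd rfl hv
    · exact pairOK_two hf .a hv eab.symm eac
    · exact P1 ebd
    · exact pairOK_two hf .a hv eab.symm (eal _ _)
    · exact pairOK_two hf (.clb k) hv (ebj k) (ej2 k).symm
    · exact pairOK_two hf .a hv eab.symm (eaj k)
    · exact P1 (ebj k)
  have Qc : ∀ v, GV.c ≠ v → PairOK (Gphi Cl) f .c v := by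
    intro v hv
    rcases v with _ | _ | _ | _ | ⟨y, s'⟩ | k | k | k
    · exact (Qa _ hv.symm).symm
    · exact (Qb _ hv.symm).symm
    · exact absurd rfl hv
    · exact P1 ecd
    · exact pairOK_two hf .a hv eac.symm (eal _ _)
    · exact P1 (ecj k)
    · exact pairOK_two hf .a hv eac.symm (eaj k)
    · exact pairOK_two hf (.cl k) hv (ecj k) (ej2 k)
  have Qd : ∀ v, GV.d ≠ v → PairOK (Gphi Cl) f .d v := by
    intro v hv
    rcases v with _ | _ | _ | _ | ⟨y, s'⟩ | k | k | k
    · exact (Qa _ hv.symm).symm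
    · exact (Qb _ hv.symm).symm
    · exact (Qc _ hv.symm).symm
    · exact absurd rfl hv
    · exact pairOK_two hf .a hv ead.symm (eal _ _)
    · exact pairOK_two hf .c hv ecd.symm (ecj k)
    · exact pairOK_two hf .a hv ead.symm (eaj k)
    · exact pairOK_two hf .b hv ebd.symm (ebj k)
  have Ql : ∀ x s v, GV.lit x s ≠ v → PairOK (Gphi Cl) f (.lit x s) v := by
    intro x s v hv
    rcases v with _ | _ | _ | _ | ⟨y, s'⟩ | k | k | k
    · exact (Qa _ hv.symm).symm
    · exact (Qb _ hv.symm).symm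
    · exact (Qc _ hv.symm).symm
    · exact (Qd _ hv.symm).symm
    · exact pairOK_two hf .a hv (eal _ _).symm (eal _ _)
    · by_cases h : σ x = s
      · refine pairOK_three hf .a .c hv (eal _ _).symm eac (ecj k) ?_
        rw [fl, if_pos h, fa, fc, fj]
        decide
      · obtain ⟨y, s', h1, h2⟩ := ht k
        refine pairOK_three hf .a (.lit y s') hv (eal _ _).symm (eal _ _) h1.symm ?_
        rw [h2, fl, if_neg h, fa, fj]
        decide
    · exact pairOK_two hf .a hv (eal _ _).symm (eaj k)
    · refine pairOK_three hf .a (.cla k) hv (eal _ _).symm (eaj k) (ej3 k) ?_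
      rw [fl, fa, fja, fjb]
      split_ifs <;> decide
  have Qj : ∀ j v, GV.cl j ≠ v → PairOK (Gphi Cl) f (.cl j) v := by
    intro j v hv
    rcases v with _ | _ | _ | _ | ⟨y, s'⟩ | k | k | k
    · exact (Qa _ hv.symm).symm
    · exact (Qb _ hv.symm).symm
    · exact (Qc _ hv.symm).symm
    · exact (Qd _ hv.symm).symm
    · exact (Ql _ _ _ hv.symm).symm
    · exact pairOK_two hf .c hv (ecj j).symm (ecj k)
    · obtain ⟨y, s', h1, h2⟩ := ht j
      refine pairOK_three hf (.lit y s') .a hv h1 (eal _ _).symm (eaj k) ?_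
      rw [h2, fa, fj, fja]
      decide
    · refine pairOK_three hf (.clb j) .b hv (ej2 j) (ebj j).symm (ebj k) ?_
      rw [fj, fb, fjb, fjb]
      decide
  have Qja : ∀ j v, GV.cla j ≠ v → PairOK (Gphi Cl) f (.cla j) v := by
    intro j v hv
    rcases v with _ | _ | _ | _ | ⟨y, s'⟩ | k | k | k
    · exact (Qa _ hv.symm).symm
    · exact (Qb _ hv.symm).symm
    · exact (Qc _ hv.symm).symm
    · exact (Qd _ hv.symm).symm
    · exact (Ql _ _ _ hv.symm).symm
    · exact (Qj _ _ hv.symm).symm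
    · exact pairOK_two hf .a hv (eaj j).symm (eaj k)
    · refine pairOK_three hf .a .b hv (eaj j).symm eab (ebj k) ?_
      rw [fja, fa, fb, fjb]
      decide
  intro u v huv
  change PairOK (Gphi Cl) f u v
  rcases u with _ | _ | _ | _ | ⟨x, s⟩ | j | j | j
  · exact Qa _ huv
  · exact Qb _ huv
  · exact Qc _ huv
  · exact Qd _ huv
  · exact Ql _ _ _ huv
  · exact Qj _ _ huv
  · exact Qja _ _ huv
  · rcases v with _ | _ | _ | _ | ⟨y, s'⟩ | k | k | k
    · exact (Qa _ huv.symm).symm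
    · exact (Qb _ huv.symm).symm
    · exact (Qc _ huv.symm).symm
    · exact (Qd _ huv.symm).symm
    · exact (Ql _ _ _ huv.symm).symm
    · exact (Qj _ _ huv.symm).symm
    · exact (Qja _ _ huv.symm).symm
    · exact pairOK_two hf .b huv (ebj j).symm (ebj k)
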